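/- arXiv:1204.5524 — 6 statements merged into one kernel-verified Lean document; each statement's English description precedes it below -/
import Mathlib

section
/- Let S be a nonempty string over an alphabet. If the run-length (RL) factorization of S consists of n_RL factors and the s-factorization of S consists of n_LZ factors, then n_LZ ≤ 2·n_RL. -/
variable {α : Type*}

/-- Decompress a run-length encoding: each pair `(a, p)` stands for `a^p`. -/
def rleDecode (l : List (α × ℕ)) : List α :=
  (l.map fun ap => List.replicate ap.2 ap.1).flatten

/-- `l` is the run-length factorization of `S`: it decodes to `S`, all exponents are
positive, and adjacent factors carry distinct characters. -/
def IsRLE (S : List α) (l : List (α × ℕ)) : Prop :=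
  rleDecode l = S ∧ (∀ ap ∈ l, 1 ≤ ap.2) ∧ l.Chain' (fun x y => x.1 ≠ y.1)

/-- `f` has an occurrence in `S` starting at a (0-indexed) position strictly before `ℓ`
(the occurrence may extend past position `ℓ`, allowing self-references). -/
def OccursBefore (S : List α) (ℓ : ℕ) (f : List α) : Prop :=
  ∃ j < ℓ, f <+: S.drop j

/-- `fs` is the s-factorization of `S` (LZ factorization with self-references):
the factors are nonempty and concatenate to `S`; the first factor is the first
character; and each subsequent factor starting at (0-indexed) position `ℓ`
with first character `c` is `[c]` if `c` does not occur before position `ℓ`,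
and otherwise is the longest prefix of the remainder that has an occurrence
in `S` starting strictly before position `ℓ` (possibly overlapping itself). -/
def IsSFactorization (S : List α) (fs : List (List α)) : Prop :=
  fs.flatten = S ∧ (∀ f ∈ fs, f ≠ []) ∧
  ∀ i (h : i < fs.length), ∀ c, (fs.get ⟨i, h⟩).head? = some c →
    ((c ∉ (fs.take i).flatten → fs.get ⟨i, h⟩ = [c]) ∧
     (c ∈ (fs.take i).flatten →
        OccursBefore S ((fs.take i).flatten).length (fs.get ⟨i, h⟩) ∧
        ∀ f', f' <+: S.drop ((fs.take i).flatten).length →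
          OccursBefore S ((fs.take i).flatten).length f' →
          f'.length ≤ (fs.get ⟨i, h⟩).length))

theorem rleDecode_cons (a : α) (p : ℕ) (l : List (α × ℕ)) :
    rleDecode ((a, p) :: l) = List.replicate p a ++ rleDecode l := by
  simp [rleDecode]

theorem drop_rleDecode_cons_of_le (a : α) {p n : ℕ} (h : n ≤ p) (l : List (α × ℕ)) :
    (rleDecode ((a, p) :: l)).drop n = rleDecode ((a, p - n) :: l) := by
  rw [rleDecode_cons, rleDecode_cons, List.drop_append_of_le_length (by simpa using h),
    List.drop_replicate]

theorem drop_rleDecode_cons_of_ge (a : α) {p n : ℕ} (h : p ≤ n) (l : List (α × ℕ)) :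
    (rleDecode ((a, p) :: l)).drop n = (rleDecode l).drop (n - p) := by
  rw [rleDecode_cons, List.drop_append, List.drop_replicate, List.length_replicate,
    Nat.sub_eq_zero_of_le h, List.replicate_zero, List.nil_append]

/-- Every suffix of a decoded run-length encoding is decoded from an encoding with no more runs. -/
theorem exists_rleDecode_eq_drop (l : List (α × ℕ)) (hl : ∀ ap ∈ l, 1 ≤ ap.2) (n : ℕ) :
    ∃ l' : List (α × ℕ), rleDecode l' = (rleDecode l).drop n ∧ l'.length ≤ l.length ∧
      ∀ ap ∈ l', 1 ≤ ap.2 := by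
  induction l generalizing n with
  | nil => exact ⟨[], by simp [rleDecode], le_rfl, hl⟩
  | cons x l ih =>
    obtain ⟨a, p⟩ := x
    rw [List.forall_mem_cons] at hl
    rcases lt_or_ge n p with h | h
    · refine ⟨(a, p - n) :: l, (drop_rleDecode_cons_of_le a h.le l).symm, by simp, ?_⟩
      rw [List.forall_mem_cons]
      exact ⟨Nat.sub_pos_of_lt h, hl.2⟩
    · obtain ⟨l', h1, h2, h3⟩ := ih hl.2 (n - p)
      exact ⟨l', by rw [h1, drop_rleDecode_cons_of_ge a h], h2.trans (by simp), h3⟩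

/-- An s-factor starting strictly inside a run reaches at least the end of that run. -/
theorem IsSFactorization.le_length_of_getLast? {S : List α} {gs t : List (List α)} {h : List α}
    (hfs : IsSFactorization S (gs ++ h :: t)) {a : α} {p : ℕ} (hp : 1 ≤ p)
    (hrun : List.replicate p a <+: (h :: t).flatten) (hlast : gs.flatten.getLast? = some a) :
    p ≤ h.length := by
  obtain ⟨hS, hne, hfac⟩ := hfs
  rw [List.flatten_append] at hS
  have hh : h ≠ [] := hne h (by simp)
  obtain ⟨g, hg⟩ := List.getLast?_eq_some_iff.mp hlast
  have hhead : h.head? = some a := by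
    obtain ⟨b, h', rfl⟩ := List.exists_cons_of_ne_nil hh
    obtain ⟨q, rfl⟩ := Nat.exists_eq_add_of_le' hp
    rw [List.replicate_succ, List.flatten_cons, List.cons_append, List.cons_prefix_cons] at hrun
    rw [List.head?_cons, hrun.1]
  have key := hfac gs.length (by simp) a (by simpa using hhead)
  simp only [List.take_left, List.get_eq_getElem, List.getElem_append_right, le_refl,
    Nat.sub_self, List.getElem_cons_zero] at key
  have hmax := (key.2 (by simp [hg])).2 (List.replicate p a)
  rw [List.length_replicate] at hmax
  refine hmax ?_ ⟨g.length, by simp [hg], ?_⟩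
  · rwa [← hS, List.drop_left]
  · rw [← hS, hg, List.append_assoc, List.drop_left, List.singleton_append]
    refine List.IsPrefix.trans ?_ (List.cons_prefix_cons.mpr ⟨rfl, hrun⟩)
    rw [← List.replicate_succ, List.replicate_succ']
    exact List.prefix_append _ _

/-- The trailing s-factors number at most twice the runs they cover, and one less if the first
of them starts strictly inside a run. -/
theorem IsSFactorization.length_le_of_append {S : List α} (hs : List (List α))
    (gs : List (List α)) (hfs : IsSFactorization S (gs ++ hs)) (l : List (α × ℕ))
    (hl : ∀ ap ∈ l, 1 ≤ ap.2) (hdec : hs.flatten = rleDecode l) :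
    hs.length ≤ 2 * l.length ∧
      ∀ a p l', l = (a, p) :: l' → gs.flatten.getLast? = some a →
        hs.length + 1 ≤ 2 * l.length := by
  induction hs generalizing gs l with
  | nil =>
    refine ⟨by simp, ?_⟩
    rintro a p l' rfl -
    simp only [List.length_nil, List.length_cons]
    omega
  | cons h t ih =>
    have hh : h ≠ [] := hfs.2.1 h (by simp)
    have hfs' : IsSFactorization S ((gs ++ [h]) ++ t) := by simpa using hfs
    have htail : t.flatten = (rleDecode l).drop h.length := by
      rw [← hdec, List.flatten_cons, List.drop_left]
    match l, hl, hdec, htail with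
    | [], _, hdec, _ => simp [rleDecode, hh] at hdec
    | (a, p) :: l, hl, hdec, htail =>
      rw [List.forall_mem_cons] at hl
      have hrun : List.replicate p a <+: (h :: t).flatten := by
        rw [hdec, rleDecode_cons]
        exact List.prefix_append _ _
      simp only [List.length_cons]
      rcases le_or_gt p h.length with hp | hp
      · obtain ⟨l₂, h1, h2, h3⟩ := exists_rleDecode_eq_drop l hl.2 (h.length - p)
        rw [drop_rleDecode_cons_of_ge a hp, ← h1] at htail
        have := (ih _ hfs' l₂ h3 htail).1
        exact ⟨by omega, fun _ _ _ _ _ => by omega⟩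
      · rw [drop_rleDecode_cons_of_le a hp.le] at htail
        have hrep : h <+: List.replicate p a :=
          List.prefix_of_prefix_length_le (List.prefix_append h t.flatten) hrun
            (by simpa using hp.le)
        have hlast : (gs ++ [h]).flatten.getLast? = some a := by
          rw [List.flatten_append, List.flatten_singleton, List.getLast?_append_of_ne_nil _ hh,
            List.getLast?_eq_some_getLast hh,
            List.eq_of_mem_replicate (hrep.subset (List.getLast_mem hh))]
        have := (ih _ hfs' ((a, p - h.length) :: l)
          (List.forall_mem_cons.mpr ⟨Nat.sub_pos_of_lt hp, hl.2⟩) htail).2 _ _ _ rfl hlast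
        rw [List.length_cons] at this
        refine ⟨by omega, fun b q l' heq hb => ?_⟩
        simp only [List.cons.injEq, Prod.mk.injEq] at heq
        obtain ⟨⟨rfl, rfl⟩, rfl⟩ := heq
        exact absurd (hfs.le_length_of_getLast? hl.1 hrun hb) (not_le.mpr hp)

/-- For a nonempty string `S`, the number of s-factors is at most
twice the number of run-length factors. -/
theorem sfact_le_two_mul_rle (S : List α) (hS : S ≠ [])
    (l : List (α × ℕ)) (hl : IsRLE S l)
    (fs : List (List α)) (hfs : IsSFactorization S fs) :
    fs.length ≤ 2 * l.length := by
  exact (IsSFactorization.length_le_of_append fs [] hfs l hl.2.1 (hfs.1.trans hl.1.symm)).1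
end

section
/- Let S be a nonempty string with RL factorization a_1^{p_1} ⋯ a_n^{p_n} and s-factorization f_1 f_2 ⋯ f_m. For each RL factor a_i^{p_i}, occupying positions b_i = 1 + Σ_{t<i} p_t through e_i = Σ_{t≤i} p_t of S, at most two of the s-factors f_1, …, f_m have their starting position in the interval [b_i, e_i]. -/
variable {α : Type*}

theorem length_rleDecode (l : List (α × ℕ)) :
    (rleDecode l).length = (l.map (·.2)).sum := by
  simp [rleDecode, List.length_flatten, Function.comp_def]

/-- A string splits around each of its run-length factors. -/
theorem rleDecode_eq_append (l : List (α × ℕ)) {i : ℕ} (hi : i < l.length) :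
    rleDecode l =
      rleDecode (l.take i) ++ (List.replicate l[i].2 l[i].1 ++ rleDecode (l.drop (i + 1))) := by
  conv_lhs => rw [← List.take_append_drop i l, List.drop_eq_getElem_cons hi]
  simp only [rleDecode, List.map_append, List.map_cons, List.flatten_append, List.flatten_cons]

theorem drop_append_replicate_append (A B : List α) (a : α) {p ℓ : ℕ}
    (hA : A.length ≤ ℓ) (hℓ : ℓ ≤ A.length + p) :
    (A ++ (List.replicate p a ++ B)).drop ℓ = List.replicate (A.length + p - ℓ) a ++ B := by
  rw [List.drop_append, List.drop_of_length_le hA, List.nil_append,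
    List.drop_append_of_le_length (by simp; omega), List.drop_replicate]
  congr 2
  omega

theorem length_flatten_take_mono (fs : List (List α)) {t u : ℕ} (h : t ≤ u) :
    ((fs.take t).flatten).length ≤ ((fs.take u).flatten).length :=
  (List.take_prefix_take_left h).sublist.flatten.length_le

theorem length_flatten_take_succ (fs : List (List α)) {u : ℕ} (hu : u < fs.length) :
    ((fs.take (u + 1)).flatten).length = ((fs.take u).flatten).length + fs[u].length := by
  rw [List.take_succ_eq_append_getElem hu]
  simp only [List.flatten_append, List.flatten_singleton, List.length_append]

/-- An s-factor starting in a run of a single character, but not at the start of that run,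
extends at least to the end of the run. -/
theorem IsSFactorization.le_length_of_start_in_run {S : List α} {fs : List (List α)}
    (hfs : IsSFactorization S fs) {A B : List α} {a : α} {p : ℕ}
    (hS : S = A ++ (List.replicate p a ++ B)) {u : ℕ} (hu : u < fs.length)
    (hA : A.length < ((fs.take u).flatten).length)
    (hp : ((fs.take u).flatten).length < A.length + p) :
    A.length + p ≤ ((fs.take (u + 1)).flatten).length := by
  obtain ⟨hflat, hne, hmax⟩ := hfs
  have hsplit : S = (fs.take u).flatten ++ (fs[u] ++ (fs.drop (u + 1)).flatten) := by
    rw [← hflat]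
    conv_lhs => rw [← List.take_append_drop u fs, List.drop_eq_getElem_cons hu]
    simp only [List.flatten_append, List.flatten_cons]
  rw [length_flatten_take_succ fs hu]
  have hmax := hmax u hu a
  simp only [List.get_eq_getElem] at hmax
  have hne := hne _ (List.getElem_mem hu)
  generalize (fs.take u).flatten = P at *
  have hdrop := drop_append_replicate_append A B a hA.le hp.le
  have hdrop' := drop_append_replicate_append A B a (p := p) (ℓ := P.length - 1) (by omega) (by omega)
  rw [← hS] at hdrop hdrop'
  have hhead : fs[u].head? = some a := by
    have h : fs[u] ++ (fs.drop (u + 1)).flatten = S.drop P.length := by simp [hsplit]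
    have h' := congrArg List.head? (h.trans hdrop)
    rw [List.head?_append_of_ne_nil _ hne, List.head?_append_of_ne_nil _ (by simp; omega),
      List.head?_replicate, if_neg (by omega)] at h'
    exact h'
  have hmem : a ∈ P := by
    have h : S[P.length - 1]? = some a := by
      have h' := congrArg List.head? hdrop'
      rwa [List.head?_drop, List.head?_append_of_ne_nil _ (by simp; omega),
        List.head?_replicate, if_neg (by omega)] at h'
    rw [hsplit, List.getElem?_append_left (by omega)] at h
    exact List.mem_of_getElem? h
  have h := ((hmax hhead).2 hmem).2 (List.replicate (A.length + p - P.length) a)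
    (hdrop ▸ List.prefix_append _ _)
    ⟨P.length - 1, by omega, by
      rw [hdrop', show A.length + p - (P.length - 1) = A.length + p - P.length + 1 by omega,
        List.replicate_add, List.append_assoc]
      exact List.prefix_append _ _⟩
  rw [List.length_replicate] at h
  omega

/-- For each run-length factor, occupying (0-indexed) positions
`[Σ_{t<i} p_t, Σ_{t≤i} p_t)` of `S`, at most two s-factors have their starting
position in that interval. -/
theorem at_most_two_sfactors_start_in_run (S : List α) (hS : S ≠ [])
    (l : List (α × ℕ)) (hl : IsRLE S l)
    (fs : List (List α)) (hfs : IsSFactorization S fs)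
    (i : ℕ) (hi : i < l.length) :
    ((Finset.range fs.length).filter (fun t =>
        ((l.take i).map (·.2)).sum ≤ ((fs.take t).flatten).length ∧
        ((fs.take t).flatten).length < ((l.take (i + 1)).map (·.2)).sum)).card ≤ 2 := by
  have hdec := hl.1.symm.trans (rleDecode_eq_append l hi)
  have hend : ((l.take (i + 1)).map (·.2)).sum = ((l.take i).map (·.2)).sum + l[i].2 := by
    rw [List.take_succ_eq_append_getElem hi]
    simp only [List.map_append, List.map_singleton, List.sum_append, List.sum_singleton]
  rw [hend, ← length_rleDecode]
  by_contra! hcard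
  obtain ⟨x, y, z, hx, hy, hz, hxy, hxz, hyz⟩ := Finset.two_lt_card.1 hcard
  simp only [Finset.mem_filter, Finset.mem_range] at hx hy hz
  have not_three : ∀ t u v : ℕ, t < u → u < v → u < fs.length →
      (rleDecode (l.take i)).length ≤ ((fs.take t).flatten).length →
      ((fs.take v).flatten).length < (rleDecode (l.take i)).length + l[i].2 → False := by
    intro t u v htu huv hu ht hv
    have hpos : 0 < (fs[t]'(htu.trans hu)).length :=
      List.length_pos_of_ne_nil (hfs.2.1 _ (List.getElem_mem _))
    have hsucc := length_flatten_take_succ fs (htu.trans hu)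
    have htu' := length_flatten_take_mono fs (Nat.succ_le_of_lt htu)
    have huv' := length_flatten_take_mono fs (Nat.succ_le_of_lt huv)
    have huv'' := length_flatten_take_mono fs huv.le
    have := hfs.le_length_of_start_in_run hdec hu (by grind) (by grind)
    grind
  rcases lt_or_gt_of_ne hxy with h₁ | h₁ <;> rcases lt_or_gt_of_ne hyz with h₂ | h₂ <;>
    rcases lt_or_gt_of_ne hxz with h₃ | h₃ <;> grind
end

section
/- Let S be a nonempty string with s-factorization f_1 f_2 ⋯ f_m and let n = size(RLE_S) be the number of RL factors of S. Then the total number of RL factors of the individual s-factors satisfies Σ_{i=1}^{m} size(RLE_{f_i}) ≤ n + m − 1. -/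
variable {α : Type*}

/-- Compute the run-length encoding of a string. -/
def rleEncode [DecidableEq α] : List α → List (α × ℕ)
  | [] => []
  | a :: t =>
    match rleEncode t with
    | [] => [(a, 1)]
    | (b, q) :: r => if a = b then (a, q + 1) :: r else (a, 1) :: (b, q) :: r

theorem exists_rleEncode_cons [DecidableEq α] (a : α) (t : List α) :
    ∃ q r, rleEncode (a :: t) = (a, q) :: r := by
  rw [rleEncode]
  split
  · exact ⟨_, _, rfl⟩
  · split_ifs
    · exact ⟨_, _, rfl⟩
    · exact ⟨_, _, rfl⟩

theorem length_rleEncode_cons_cons [DecidableEq α] (a b : α) (t : List α) :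
    (rleEncode (a :: b :: t)).length =
      (rleEncode (b :: t)).length + if a = b then 0 else 1 := by
  obtain ⟨q, r, h⟩ := exists_rleEncode_cons b t
  rw [rleEncode, h]
  dsimp only
  split_ifs <;> simp

theorem length_rleEncode_le_cons [DecidableEq α] (a : α) (t : List α) :
    (rleEncode t).length ≤ (rleEncode (a :: t)).length := by
  cases t with
  | nil => simp [rleEncode]
  | cons b t => rw [length_rleEncode_cons_cons]; omega

theorem length_rleEncode_add_le_append [DecidableEq α] (s t : List α) :
    (rleEncode s).length + (rleEncode t).length ≤ (rleEncode (s ++ t)).length + 1 := by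
  induction s with
  | nil => simp [rleEncode]
  | cons a s ih =>
    cases s with
    | nil =>
      have h := length_rleEncode_le_cons a t
      simp only [rleEncode, List.length_singleton, List.cons_append, List.nil_append] at h ⊢
      omega
    | cons b s =>
      simp only [List.cons_append, length_rleEncode_cons_cons] at ih ⊢
      omega

theorem sum_length_rleEncode_le_flatten [DecidableEq α] (fs : List (List α)) :
    (fs.map fun f => (rleEncode f).length).sum ≤
      (rleEncode fs.flatten).length + fs.length - 1 := by
  induction fs with
  | nil => simp
  | cons f fs ih =>
    cases fs with
    | nil => simp
    | cons g fs =>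
      have h := length_rleEncode_add_le_append f (g :: fs).flatten
      rw [List.map_cons, List.sum_cons, List.flatten_cons, List.length_cons]
      rw [List.length_cons] at ih ⊢
      omega

/-- If `S` has s-factorization `fs` (with `m` factors) and `n` RL
factors, then the total number of RL factors of the individual s-factors is at most
`n + m - 1`. -/
theorem sum_rle_sizes_of_sfactors [DecidableEq α] (S : List α) (hS : S ≠ [])
    (fs : List (List α)) (hfs : IsSFactorization S fs) :
    (fs.map fun f => (rleEncode f).length).sum ≤ (rleEncode S).length + fs.length - 1 := by
  rw [← hfs.1]
  exact sum_length_rleEncode_le_flatten fs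
end

section
/- Let S be a nonempty string over a linearly ordered alphabet with RL factorization a_1^{p_1}⋯a_n^{p_n}, and let rs = RLE_SA_S. Then: (1) for all indices 1 ≤ i < j < j' ≤ n, |lcp(val(RLE_S[rs(i)..n]), val(RLE_S[rs(j)..n]))| ≥ |lcp(val(RLE_S[rs(i)..n]), val(RLE_S[rs(j')..n]))|; and (2) for all indices 1 ≤ i' < i < j ≤ n, |lcp(val(RLE_S[rs(i)..n]), val(RLE_S[rs(j)..n]))| ≥ |lcp(val(RLE_S[rs(i')..n]), val(RLE_S[rs(j)..n]))|. That is, RLE suffixes closer in RLE-suffix-array order have longer longest common prefixes after decompression. -/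
variable {α : Type*}

/-- The order `≺` on RL factors: `a^p ≺ b^q` iff `a < b`, or `a = b` and `p < q`. -/
def RLLt [LT α] (x y : α × ℕ) : Prop :=
  x.1 < y.1 ∨ (x.1 = y.1 ∧ x.2 < y.2)

/-- Length of the longest common prefix of two lists. -/
def lcpLength [DecidableEq α] : List α → List α → ℕ
  | [], _ => 0
  | _, [] => 0
  | a :: x, b :: y => if a = b then lcpLength x y + 1 else 0

section LcpLength

variable [DecidableEq α]

@[simp]
theorem lcpLength_nil_left (x : List α) : lcpLength [] x = 0 := by
  simp [lcpLength]

theorem lcpLength_append (u v w : List α) :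
    lcpLength (u ++ v) (u ++ w) = u.length + lcpLength v w := by
  induction u with
  | nil => simp
  | cons a u ih =>
    simp only [List.cons_append, lcpLength, if_true, ih, List.length_cons]
    omega

theorem le_lcpLength_replicate_append (a : α) {p q r : ℕ} (hq : p ≤ q) (hr : p ≤ r)
    (u v : List α) :
    p ≤ lcpLength (List.replicate q a ++ u) (List.replicate r a ++ v) := by
  obtain ⟨k, rfl⟩ := Nat.exists_eq_add_of_le hq
  obtain ⟨m, rfl⟩ := Nat.exists_eq_add_of_le hr
  rw [List.replicate_add, List.replicate_add, List.append_assoc, List.append_assoc,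
    lcpLength_append, List.length_replicate]
  exact Nat.le_add_right _ _

theorem lcpLength_replicate_append_of_ne {a b : α} (hab : a ≠ b) {p q : ℕ} (hp : 1 ≤ p)
    (hq : 1 ≤ q) (u v : List α) :
    lcpLength (List.replicate p a ++ u) (List.replicate q b ++ v) = 0 := by
  obtain ⟨p, rfl⟩ := Nat.exists_eq_add_of_le' hp
  obtain ⟨q, rfl⟩ := Nat.exists_eq_add_of_le' hq
  simp [List.replicate_succ, lcpLength, hab]

/-- When the first factors share their letter and the left one is shorter, the decompressed
strings agree exactly on the left factor. -/
theorem lcpLength_rleDecode_cons_of_lt {a : α} {p r : ℕ} (hpr : p < r) {x : List (α × ℕ)}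
    (hpos : ∀ f ∈ x, 1 ≤ f.2)
    (hchain : ((a, p) :: x).IsChain (fun f g => f.1 ≠ g.1)) (z : List (α × ℕ)) :
    lcpLength (rleDecode ((a, p) :: x)) (rleDecode ((a, r) :: z)) = p := by
  obtain ⟨k, rfl⟩ := Nat.exists_eq_add_of_lt hpr
  rw [rleDecode_cons, rleDecode_cons, Nat.add_assoc, List.replicate_add, List.append_assoc,
    lcpLength_append, List.length_replicate, Nat.add_eq_left]
  cases x with
  | nil => simp [rleDecode]
  | cons f x =>
    obtain ⟨b, q⟩ := f
    rw [rleDecode_cons]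
    exact lcpLength_replicate_append_of_ne (List.isChain_cons_cons.mp hchain).1.symm
      (hpos (b, q) List.mem_cons_self) (Nat.le_add_left 1 k) _ _

end LcpLength

/-- For run-length encodings `x ≺ y ≺ z`, the longest common prefix of the decompressed
outer pair is no longer than that of either inner pair. -/
theorem lcpLength_rleDecode_le_of_lex [LinearOrder α] {x y z : List (α × ℕ)}
    (hx : ∀ f ∈ x, 1 ≤ f.2) (hxc : x.IsChain (fun f g => f.1 ≠ g.1))
    (hy : ∀ f ∈ y, 1 ≤ f.2) (hyc : y.IsChain (fun f g => f.1 ≠ g.1))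
    (hz : ∀ f ∈ z, 1 ≤ f.2)
    (hxy : List.Lex RLLt x y) (hyz : List.Lex RLLt y z) :
    lcpLength (rleDecode x) (rleDecode z) ≤ lcpLength (rleDecode x) (rleDecode y) ∧
      lcpLength (rleDecode x) (rleDecode z) ≤ lcpLength (rleDecode y) (rleDecode z) := by
  induction hxy generalizing z with
  | nil => simp [rleDecode]
  | @rel f x g y hfg =>
    obtain ⟨a, p⟩ := f
    obtain ⟨b, q⟩ := g
    obtain ⟨c, r, z, rfl, hbc⟩ : ∃ c r z', z = (c, r) :: z' ∧ (b < c ∨ b = c ∧ q ≤ r) := by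
      cases hyz with
      | @rel _ _ h _ hgh => exact ⟨h.1, h.2, _, rfl, hgh.imp_right fun h => ⟨h.1, h.2.le⟩⟩
      | cons _ => exact ⟨b, q, _, rfl, Or.inr ⟨rfl, le_rfl⟩⟩
    have hab : a < b ∨ a = b ∧ p < q := hfg
    by_cases hac : a = c
    · subst hac
      obtain rfl : a = b := by
        rcases hab with h | h
        · rcases hbc with h' | h'
          · exact absurd h' h.asymm
          · exact h'.1.symm
        · exact h.1
      have hpq : p < q := by simpa using hab
      have hqr : q ≤ r := by simpa using hbc
      rw [lcpLength_rleDecode_cons_of_lt (hpq.trans_le hqr) (List.forall_mem_cons.mp hx).2 hxc,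
        lcpLength_rleDecode_cons_of_lt hpq (List.forall_mem_cons.mp hx).2 hxc,
        rleDecode_cons, rleDecode_cons]
      exact ⟨le_rfl, le_lcpLength_replicate_append a hpq.le (hpq.le.trans hqr) _ _⟩
    · rw [rleDecode_cons a, rleDecode_cons c, lcpLength_replicate_append_of_ne hac
        (hx (a, p) List.mem_cons_self) (hz (c, r) List.mem_cons_self)]
      exact ⟨Nat.zero_le _, Nat.zero_le _⟩
  | @cons f x y hxy ih =>
    obtain ⟨a, p⟩ := f
    cases hyz with
    | @rel _ _ h z hgh =>
      obtain ⟨c, r⟩ := h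
      by_cases hac : a = c
      · subst hac
        have hpr : p < r := by simpa [RLLt] using hgh
        rw [lcpLength_rleDecode_cons_of_lt hpr (List.forall_mem_cons.mp hx).2 hxc,
          lcpLength_rleDecode_cons_of_lt hpr (List.forall_mem_cons.mp hy).2 hyc,
          rleDecode_cons, rleDecode_cons]
        exact ⟨le_lcpLength_replicate_append a le_rfl le_rfl _ _, le_rfl⟩
      · rw [rleDecode_cons a, rleDecode_cons c, lcpLength_replicate_append_of_ne hac
          (hx (a, p) List.mem_cons_self) (hz (c, r) List.mem_cons_self)]
        exact ⟨Nat.zero_le _, Nat.zero_le _⟩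
    | cons hyz =>
      have := ih (List.forall_mem_cons.mp hx).2 hxc.tail (List.forall_mem_cons.mp hy).2 hyc.tail
        (List.forall_mem_cons.mp hz).2 hyz
      simpa only [rleDecode_cons, lcpLength_append, Nat.add_le_add_iff_left] using this

/-- Let `rs` be the RLE suffix array of `S` (a bijection on `Fin n`
listing the suffixes `RLE_S[j..n]` in increasing lexicographic `≺`-order).
Then RLE suffixes closer in suffix-array order have longer longest common prefixes
after decompression:
(1) for `i < j < j'`, `|lcp(val(suffix rs i), val(suffix rs j))| ≥ |lcp(val(suffix rs i), val(suffix rs j'))|`;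
(2) for `i' < i < j`, `|lcp(val(suffix rs i), val(suffix rs j))| ≥ |lcp(val(suffix rs i'), val(suffix rs j))|`. -/
theorem rle_suffix_array_lcp_monotone [LinearOrder α]
    (S : List α) (hS : S ≠ [])
    (l : List (α × ℕ)) (hl : IsRLE S l)
    (rs : Fin l.length → Fin l.length) (hrs : Function.Bijective rs)
    (hsorted : ∀ i j : Fin l.length, i < j →
      List.Lex RLLt (l.drop (rs i : ℕ)) (l.drop (rs j : ℕ))) :
    (∀ i j j' : Fin l.length, i < j → j < j' →
      lcpLength (rleDecode (l.drop (rs i : ℕ))) (rleDecode (l.drop (rs j' : ℕ))) ≤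
        lcpLength (rleDecode (l.drop (rs i : ℕ))) (rleDecode (l.drop (rs j : ℕ)))) ∧
    (∀ i' i j : Fin l.length, i' < i → i < j →
      lcpLength (rleDecode (l.drop (rs i' : ℕ))) (rleDecode (l.drop (rs j : ℕ))) ≤
        lcpLength (rleDecode (l.drop (rs i : ℕ))) (rleDecode (l.drop (rs j : ℕ)))) := by
  have hpos : ∀ k, ∀ f ∈ l.drop k, 1 ≤ f.2 := fun k f hf => hl.2.1 f (List.mem_of_mem_drop hf)
  have hchain : ∀ k, (l.drop k).IsChain (fun f g => f.1 ≠ g.1) := fun k => hl.2.2.drop k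
  have key := fun (i j k : Fin l.length) (hij : i < j) (hjk : j < k) =>
    lcpLength_rleDecode_le_of_lex (hpos (rs i)) (hchain (rs i)) (hpos (rs j)) (hchain (rs j))
      (hpos (rs k)) (hsorted i j hij) (hsorted j k hjk)
  exact ⟨fun i j j' hij hjj' => (key i j j' hij hjj').1,
    fun i' i j hi hij => (key i' i j hi hij).2⟩
end

section
/- Let S be a string of length N over an alphabet with RL factorization a_1^{p_1}⋯a_n^{p_n} and s-factorization f_1⋯f_m. Fix j, let ℓ = |f_1⋯f_{j-1}| + 1 be the starting position of f_j, let d = min{ t : Σ_{i=1}^{t} p_i ≥ ℓ } + 1 (so the (d−1)-th RL factor contains position ℓ), and let q = Σ_{i=1}^{d-1} p_i − ℓ + 1 (so 1 ≤ q ≤ p_{d-1}). If q < p_{d-1}, or there exists an index i with 1 ≤ i ≤ d−2, a_i = a_{d-1}, and p_i ≥ q, then |f_j| ≥ q. -/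
variable {α : Type*}

theorem rleDecode_append (l₁ l₂ : List (α × ℕ)) :
    rleDecode (l₁ ++ l₂) = rleDecode l₁ ++ rleDecode l₂ := by
  simp [rleDecode]

theorem sum_map_snd_take_succ (l : List (α × ℕ)) (i : ℕ) (h : i < l.length) :
    ((l.take (i + 1)).map (·.2)).sum = ((l.take i).map (·.2)).sum + (l.get ⟨i, h⟩).2 := by
  rw [List.take_succ_eq_append_getElem h, List.map_append, List.sum_append]
  simp

/-- The decoded string carries the `i`-th run at the total length of the runs before it. -/
theorem replicate_prefix_drop_rleDecode (l : List (α × ℕ)) (i : ℕ) (h : i < l.length) :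
    List.replicate (l.get ⟨i, h⟩).2 (l.get ⟨i, h⟩).1 <+:
      (rleDecode l).drop ((l.take i).map (·.2)).sum := by
  conv_rhs => rw [← List.take_append_drop i l, rleDecode_append, List.take_append_drop i l]
  rw [← length_rleDecode, List.drop_left, List.drop_eq_getElem_cons h]
  exact ⟨rleDecode (l.drop (i + 1)), rfl⟩

theorem replicate_prefix_replicate {m n : ℕ} (a : α) (h : m ≤ n) :
    List.replicate m a <+: List.replicate n a :=
  ⟨List.replicate (n - m) a, by rw [List.replicate_append_replicate, Nat.add_sub_cancel' h]⟩

/-- A nonempty power of `a` that starts an s-factor's suffix and occurs earlier is no longer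
than that s-factor. -/
theorem IsSFactorization.le_length_of_occursBefore {S : List α} {fs : List (List α)}
    (hfs : IsSFactorization S fs) (i : ℕ) (hi : i < fs.length) {q : ℕ} (hq : 0 < q) (a : α)
    (hpre : List.replicate q a <+: S.drop ((fs.take i).flatten).length)
    (hocc : OccursBefore S ((fs.take i).flatten).length (List.replicate q a)) :
    q ≤ (fs.get ⟨i, hi⟩).length := by
  obtain ⟨hflat, hne, hmax⟩ := hfs
  have hsplit : (fs.take i).flatten ++ (fs.drop i).flatten = S := by
    rw [← List.flatten_append, List.take_append_drop, hflat]
  have hdrop : S.drop ((fs.take i).flatten).length = fs[i] ++ (fs.drop (i + 1)).flatten := by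
    rw [← hsplit, List.drop_left, List.drop_eq_getElem_cons hi, List.flatten_cons]
  have hhead : (fs.get ⟨i, hi⟩).head? = some a := by
    obtain ⟨t, ht⟩ := hpre
    have hnil : fs[i] ≠ [] := hne _ (List.getElem_mem hi)
    have := congrArg List.head? (ht.trans hdrop)
    rw [List.head?_append_of_ne_nil _ hnil] at this
    simpa [List.head?_append, List.head?_replicate, hq.ne'] using this.symm
  have hmem : a ∈ (fs.take i).flatten := by
    obtain ⟨j, hj, t, ht⟩ := hocc
    have hSj : S[j]? = some a := by
      rw [← List.head?_drop, ← ht]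
      simp [List.head?_append, List.head?_replicate, hq.ne']
    rw [← hsplit, List.getElem?_append_left hj] at hSj
    exact List.mem_of_getElem? hSj
  simpa using ((hmax i hi a hhead).2 hmem).2 _ hpre hocc

/-- Suppose the s-factor `f_j` (0-indexed `jf`) starts at
0-indexed position `ℓ0` inside the RL factor of 0-indexed index `d0`, and
`q = Σ_{i ≤ d0+1} p_i − ℓ0` positions of that run remain. If `q < p_{d0}`, or some
earlier RL factor has the same character and exponent at least `q`, then `|f_j| ≥ q`. -/
theorem sfactor_length_at_least_q (S : List α) (hS : S ≠ [])
    (l : List (α × ℕ)) (hl : IsRLE S l)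
    (fs : List (List α)) (hfs : IsSFactorization S fs)
    (jf : ℕ) (hjf : jf < fs.length)
    (d0 : ℕ) (hd0 : d0 < l.length)
    (hlo : ((l.take d0).map (·.2)).sum ≤ ((fs.take jf).flatten).length)
    (hhi : ((fs.take jf).flatten).length < ((l.take (d0 + 1)).map (·.2)).sum) :
    let ℓ0 := ((fs.take jf).flatten).length
    let q := ((l.take (d0 + 1)).map (·.2)).sum - ℓ0
    q < (l.get ⟨d0, hd0⟩).2 ∨
      (∃ i0, ∃ h : i0 < d0, (l.get ⟨i0, h.trans hd0⟩).1 = (l.get ⟨d0, hd0⟩).1 ∧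
        q ≤ (l.get ⟨i0, h.trans hd0⟩).2) →
      q ≤ (fs.get ⟨jf, hjf⟩).length := by
  intro ℓ0 q hcase
  obtain ⟨hdec, hpos, -⟩ := hl
  have hrun (i : ℕ) (h : i < l.length) := replicate_prefix_drop_rleDecode l i h
  rw [hdec] at hrun
  have hq : q = ((l.take (d0 + 1)).map (·.2)).sum - ℓ0 := rfl
  have hsum := sum_map_snd_take_succ l d0 hd0
  refine hfs.le_length_of_occursBefore jf hjf (by omega) (l.get ⟨d0, hd0⟩).1 ?_ ?_
  · have h := (hrun d0 hd0).drop (ℓ0 - ((l.take d0).map (·.2)).sum)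
    rw [List.drop_drop, List.drop_replicate, Nat.add_sub_cancel' hlo] at h
    exact (replicate_prefix_replicate _ (by omega)).trans h
  · rcases hcase with hlt | ⟨i0, hi0, hchar, hle⟩
    · exact ⟨_, by omega, (replicate_prefix_replicate _ hlt.le).trans (hrun d0 hd0)⟩
    · have hi := hi0.trans hd0
      refine ⟨((l.take i0).map (·.2)).sum, ?_, ?_⟩
      · have hsucc := sum_map_snd_take_succ l i0 hi
        have hp := hpos _ (List.get_mem l ⟨i0, hi⟩)
        have hmono : ((l.take (i0 + 1)).map (·.2)).sum ≤ ((l.take d0).map (·.2)).sum :=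
          ((List.take_sublist_take_left (Nat.succ_le_of_lt hi0)).map _).sum_le_sum
            fun _ _ => Nat.zero_le _
        omega
      · rw [← hchar]
        exact (replicate_prefix_replicate _ hle).trans (hrun i0 hi)
end

section
/- For any string T of length n ≥ 1 over an alphabet, the number of EndPos-equivalence classes of substrings of T (including the class of the empty string) is at most 2n. Equivalently, the set { EndPos_T(u) : u a substring of T } has cardinality at most 2n. -/
variable {α : Type*}

/-- The set of (1-indexed) ending positions of occurrences of `u` in `T`;
`j ∈ EndPos T u` iff `u` is a suffix of the length-`j` prefix of `T`
(so `EndPos T [] = {0, …, |T|}`). -/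
def EndPos (T u : List α) : Set ℕ :=
  { j | j ≤ T.length ∧ u <:+ T.take j }

/-- A laminar family of nonempty subsets of a nonempty finite set `S` has at most `2 |S| - 1`
members. -/
theorem card_add_one_le_of_laminar {β : Type*} [DecidableEq β] {S : Finset β} (hS : S.Nonempty)
    (F : Finset (Finset β)) (hF : ∀ A ∈ F, A ⊆ S ∧ A.Nonempty)
    (hlam : ∀ A ∈ F, ∀ B ∈ F, Disjoint A B ∨ A ⊆ B ∨ B ⊆ A) :
    F.card + 1 ≤ 2 * S.card := by
  induction hS using Finset.Nonempty.cons_induction generalizing F with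
  | singleton x =>
    have hsub : F ⊆ {{x}} := by
      intro A hA
      obtain ⟨h, hne⟩ := hF A hA
      exact Finset.mem_singleton.2 (hne.subset_singleton_iff.1 h)
    simpa using Finset.card_le_card hsub
  | cons x S hx hS ih =>
    set F' := F.erase {x}
    set P := F'.filter fun A => x ∈ A ∧ A.erase x ∈ F with hP
    have hne : ∀ A ∈ F', (A.erase x).Nonempty := by
      intro A hA
      rw [Finset.mem_erase] at hA
      rw [Finset.nonempty_iff_ne_empty, Ne, Finset.erase_eq_empty_iff]
      exact not_or.2 ⟨(hF A hA.2).2.ne_empty, hA.1⟩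
    have hsubset : ∀ A ∈ P, ∀ B ∈ P, A ⊆ B → B ⊆ A := by
      intro A hA B hB hAB
      simp only [hP, Finset.mem_filter] at hA hB
      obtain ⟨y, hy⟩ := hne A hA.1
      rcases hlam A (Finset.mem_of_mem_erase hA.1) _ hB.2.2 with h | h | h
      · exact absurd (Finset.erase_subset_erase x hAB hy)
          (Finset.disjoint_left.1 h (Finset.mem_of_mem_erase hy))
      · exact absurd (h hA.2.1) (Finset.notMem_erase x B)
      · rw [← Finset.insert_erase hB.2.1]
        exact Finset.insert_subset hA.2.1 h
    have hPcard : P.card ≤ 1 := by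
      refine Finset.card_le_one.2 fun A hA B hB => ?_
      have hA' := Finset.mem_filter.1 hA
      have hB' := Finset.mem_filter.1 hB
      rcases hlam A (Finset.mem_of_mem_erase hA'.1) B (Finset.mem_of_mem_erase hB'.1) with
        h | h | h
      · exact absurd hB'.2.1 (Finset.disjoint_left.1 h hA'.2.1)
      · exact h.antisymm (hsubset A hA B hB h)
      · exact (hsubset B hB A hA h).antisymm h
    have hinj : Set.InjOn (fun A : Finset β => A.erase x) (F' \ P : Finset (Finset β)) := by
      have key : ∀ A ∈ F' \ P, ∀ B ∈ F' \ P, A.erase x = B.erase x → x ∈ A → x ∈ B := by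
        intro A hA B hB hAB hxA
        by_contra hxB
        rw [Finset.erase_eq_of_notMem hxB] at hAB
        rw [Finset.mem_sdiff] at hA hB
        exact hA.2 (Finset.mem_filter.2
          ⟨hA.1, hxA, hAB ▸ Finset.mem_of_mem_erase hB.1⟩)
      intro A hA B hB hAB
      ext y
      by_cases hy : y = x
      · subst hy
        exact ⟨key A hA B hB hAB, key B hB A hA hAB.symm⟩
      · simpa [hy] using Finset.ext_iff.1 hAB y
    have hG := ih ((F' \ P).image fun A => A.erase x) (by
      simp only [Finset.mem_image, Finset.mem_sdiff]
      rintro _ ⟨A, ⟨hA, -⟩, rfl⟩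
      refine ⟨?_, hne A hA⟩
      have h := (hF A (Finset.mem_of_mem_erase hA)).1
      rw [Finset.cons_eq_insert] at h
      exact Finset.subset_insert_iff.1 h) (by
      simp only [Finset.mem_image, Finset.mem_sdiff]
      rintro _ ⟨A, ⟨hA, -⟩, rfl⟩ _ ⟨B, ⟨hB, -⟩, rfl⟩
      rcases hlam A (Finset.mem_of_mem_erase hA) B (Finset.mem_of_mem_erase hB) with h | h | h
      · exact Or.inl (h.mono (Finset.erase_subset x A) (Finset.erase_subset x B))
      · exact Or.inr (Or.inl (Finset.erase_subset_erase x h))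
      · exact Or.inr (Or.inr (Finset.erase_subset_erase x h)))
    rw [Finset.card_image_of_injOn hinj] at hG
    have h1 : F.card ≤ F'.card + 1 := by
      have : F.card - 1 ≤ F'.card := Finset.pred_card_le_card_erase
      omega
    have h2 : F'.card ≤ (F' \ P).card + P.card := by
      rw [Finset.card_sdiff_add_card_eq_card (Finset.filter_subset _ _)]
    rw [Finset.card_cons]
    omega

theorem EndPos_nonempty_of_infix {T u : List α} (h : u <:+: T) : (EndPos T u).Nonempty := by
  obtain ⟨s, t, rfl⟩ := h
  refine ⟨(s ++ u).length, by simp, ?_⟩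
  rw [List.take_left]
  exact List.suffix_append s u

theorem EndPos_subset_of_suffix {T u v : List α} (h : u <:+ v) : EndPos T v ⊆ EndPos T u :=
  fun _ hj => ⟨hj.1, h.trans hj.2⟩

theorem EndPos_disjoint_or_subset (T u v : List α) :
    Disjoint (EndPos T u) (EndPos T v) ∨ EndPos T u ⊆ EndPos T v ∨
      EndPos T v ⊆ EndPos T u := by
  by_cases h : Disjoint (EndPos T u) (EndPos T v)
  · exact Or.inl h
  · obtain ⟨j, hu, hv⟩ := Set.not_disjoint_iff.1 h
    rcases List.suffix_or_suffix_of_suffix hu.2 hv.2 with h | h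
    · exact Or.inr (Or.inr (EndPos_subset_of_suffix h))
    · exact Or.inr (Or.inl (EndPos_subset_of_suffix h))

theorem EndPos_subset_Icc {T u : List α} (hu : u ≠ []) :
    EndPos T u ⊆ Finset.Icc 1 T.length := by
  rintro j ⟨hj, hs⟩
  rw [Finset.coe_Icc]
  refine ⟨Nat.one_le_iff_ne_zero.2 ?_, hj⟩
  rintro rfl
  exact hu (by simpa using hs)

/-- For a nonempty string `T` of length `n`, the number of
EndPos-equivalence classes of substrings of `T` (i.e. the number of distinct sets
`EndPos T u` over substrings `u`, including the class of the empty string) is at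
most `2n`. -/
theorem card_endPos_classes_le (T : List α) (hT : T ≠ []) :
    { E : Set ℕ | ∃ u : List α, u <:+: T ∧ E = EndPos T u }.ncard ≤ 2 * T.length := by
  classical
  let F : Finset (Finset ℕ) := (Finset.Icc 1 T.length).powerset.filter
    fun A => ∃ u : List α, u <:+: T ∧ (A : Set ℕ) = EndPos T u
  have hcard : F.card + 1 ≤ 2 * (Finset.Icc 1 T.length).card := by
    refine card_add_one_le_of_laminar
      (Finset.nonempty_Icc.2 (Nat.one_le_iff_ne_zero.2 (List.length_pos_iff.2 hT).ne')) F ?_ ?_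
    · intro A hA
      obtain ⟨hA, u, hu, hAu⟩ := Finset.mem_filter.1 hA
      refine ⟨Finset.mem_powerset.1 hA, ?_⟩
      rw [← Finset.coe_nonempty, hAu]
      exact EndPos_nonempty_of_infix hu
    · intro A hA B hB
      obtain ⟨-, u, -, hAu⟩ := Finset.mem_filter.1 hA
      obtain ⟨-, v, -, hBv⟩ := Finset.mem_filter.1 hB
      rw [← Finset.disjoint_coe, ← Finset.coe_subset, ← Finset.coe_subset, hAu, hBv]
      exact EndPos_disjoint_or_subset T u v
  have hsub : { E : Set ℕ | ∃ u : List α, u <:+: T ∧ E = EndPos T u } ⊆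
      (insert (EndPos T []) (F.image fun A : Finset ℕ => (A : Set ℕ)) : Finset (Set ℕ)) := by
    rintro _ ⟨u, hu, rfl⟩
    rw [Finset.mem_coe, Finset.mem_insert]
    by_cases h : u = []
    · exact Or.inl (h ▸ rfl)
    · obtain ⟨A, hA⟩ :=
        ((Finset.finite_toSet _).subset (EndPos_subset_Icc (T := T) h)).exists_finset_coe
      have hAsub : A ⊆ Finset.Icc 1 T.length := by
        rw [← Finset.coe_subset, hA]
        exact EndPos_subset_Icc h
      have hAF : A ∈ F := Finset.mem_filter.2 ⟨Finset.mem_powerset.2 hAsub, u, hu, hA⟩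
      rw [← hA]
      exact Or.inr (Finset.mem_image_of_mem _ hAF)
  calc _ ≤ _ := Set.ncard_le_ncard hsub (Finset.finite_toSet _)
    _ ≤ F.card + 1 := by
      rw [Set.ncard_coe_finset]
      exact (Finset.card_insert_le _ _).trans (Nat.add_le_add_right Finset.card_image_le 1)
    _ ≤ 2 * T.length := by simpa using hcard
end
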